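/- The Schlumprecht space S is isomorphic (linearly homeomorphic) to its square S ⊕ S. -/

import Mathlib

open Filter Topology

noncomputable section

/-- `f(t) = log₂(t+1)`. -/
def schF (t : ℝ) : ℝ := Real.logb 2 (t + 1)

/-- For a finitely supported scalar sequence `a`, the vector `Σᵢ aᵢ eᵢ`. -/
def embed {S : Type*} [NormedAddCommGroup S] [NormedSpace ℝ S] (e : ℕ → S) (a : ℕ →₀ ℝ) : S :=
  a.sum fun i c => c • e i

/-- The restriction `Ex` of `x = Σ aᵢ eᵢ` to the coordinates in the finite set `E`. -/
def restr (a : ℕ →₀ ℝ) (E : Finset ℕ) : ℕ →₀ ℝ := a.filter (· ∈ E)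

/-- `E₁ < E₂ < ⋯ < E_r` : a successive family of finite subsets of ℕ. -/
def Succ {r : ℕ} (E : Fin r → Finset ℕ) : Prop :=
  ∀ i j : Fin r, i < j → ∀ m ∈ E i, ∀ n ∈ E j, m < n

/-- `S` is (a realization of) the Schlumprecht space with unit vector basis `e`:
a Banach space in which the span of `e` is dense and whose norm satisfies, on the
finitely supported vectors `Σ aᵢ eᵢ`, the implicit Schlumprecht equation. -/
structure IsSchlumprecht (S : Type*) [NormedAddCommGroup S] [NormedSpace ℝ S] (e : ℕ → S) :
    Prop where
  dense_span : Dense (Submodule.span ℝ (Set.range e) : Set S)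
  norm_eq : ∀ a : ℕ →₀ ℝ,
    ‖embed e a‖ = max (⨆ i, |a i|)
      (sSup {c : ℝ | ∃ r : ℕ, 2 ≤ r ∧ ∃ E : Fin r → Finset ℕ, Succ E ∧
        c = (schF r)⁻¹ * ∑ i, ‖embed e (restr a (E i))‖})

/-- `b` is a normalized block basis of the unit vector basis `e`. -/
def IsNormalizedBlockBasis {S : Type*} [NormedAddCommGroup S] [NormedSpace ℝ S] (e : ℕ → S)
    (b : ℕ → ℕ →₀ ℝ) : Prop :=
  (∀ k, b k ≠ 0) ∧ (∀ k, ∀ m ∈ (b k).support, ∀ n ∈ (b (k + 1)).support, m < n) ∧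
  (∀ k, ‖embed e (b k)‖ = 1)

/-- The series `Σ g k` converges to `s` (convergence of partial sums). -/
def SeriesSum {S : Type*} [AddCommMonoid S] [TopologicalSpace S] (g : ℕ → S) (s : S) : Prop :=
  Tendsto (fun m => ∑ k ∈ Finset.range m, g k) atTop (𝓝 s)

/-- `V` is isomorphic (linearly homeomorphic) to the S-sum `(Σₖ ⊕ X k)_S`,
where the S-sum consists of all `y : Π k, X k` such that `Σₖ ‖y k‖ e k` converges in `S`,
normed by `‖Σₖ ‖y k‖ e k‖`. -/
def IsoToSSum {S : Type*} [NormedAddCommGroup S] [NormedSpace ℝ S] (e : ℕ → S)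
    (V : Type*) [NormedAddCommGroup V] [Module ℝ V]
    (X : ℕ → Type*) [∀ k, NormedAddCommGroup (X k)] [∀ k, Module ℝ (X k)] : Prop :=
  ∃ (T : V →ₗ[ℝ] Π k, X k) (A B : ℝ), 0 < A ∧ 0 < B ∧
    (Set.range T = {y | ∃ s : S, SeriesSum (fun k => ‖y k‖ • e k) s}) ∧
    ∀ v : V, ∃ s : S, SeriesSum (fun k => ‖T v k‖ • e k) s ∧
      A * ‖v‖ ≤ ‖s‖ ∧ ‖s‖ ≤ B * ‖v‖

theorem one_lt_schF_two : 1 < schF 2 := by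
  rw [schF, Real.lt_logb_iff_rpow_lt (by norm_num) (by norm_num)]
  norm_num

theorem schF_two_le {r : ℕ} (hr : 2 ≤ r) : schF 2 ≤ schF r := by
  have : (2 : ℝ) ≤ r := by exact_mod_cast hr
  exact Real.logb_le_logb_of_le (by norm_num) (by norm_num) (by linarith)

theorem restr_apply (a : ℕ →₀ ℝ) (E : Finset ℕ) (n : ℕ) :
    restr a E n = if n ∈ E then a n else 0 := by
  simp [restr, Finsupp.filter_apply]

theorem support_restr (a : ℕ →₀ ℝ) (E : Finset ℕ) :
    (restr a E).support = a.support.filter (· ∈ E) := by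
  simp [restr]

theorem restr_eq_self {a : ℕ →₀ ℝ} {E : Finset ℕ} (h : a.support ⊆ E) : restr a E = a :=
  (Finsupp.filter_eq_self_iff _ _).2 fun n hn => h (Finsupp.mem_support_iff.2 hn)

section Seq

variable {S : Type*} [NormedAddCommGroup S] [NormedSpace ℝ S] {e : ℕ → S}

theorem embed_zero : embed e 0 = 0 := Finsupp.sum_zero_index

theorem norm_embed_restr_le (a : ℕ →₀ ℝ) (E : Finset ℕ) :
    ‖embed e (restr a E)‖ ≤ ∑ n ∈ a.support.filter (· ∈ E), ‖a n • e n‖ := by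
  rw [embed, Finsupp.sum, support_restr]
  refine (norm_sum_le _ _).trans (Finset.sum_le_sum fun n hn => ?_)
  rw [restr_apply, if_pos (Finset.mem_filter.1 hn).2]

theorem sum_norm_embed_restr_le (a : ℕ →₀ ℝ) {r : ℕ} {E : Fin r → Finset ℕ} (hE : Succ E) :
    ∑ i, ‖embed e (restr a (E i))‖ ≤ ∑ n ∈ a.support, ‖a n • e n‖ := by
  refine (Finset.sum_le_sum fun i _ => norm_embed_restr_le a (E i)).trans ?_
  rw [← Finset.sum_biUnion]
  · refine Finset.sum_le_sum_of_subset_of_nonneg ?_ fun _ _ _ => norm_nonneg _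
    exact Finset.biUnion_subset.2 fun i _ => Finset.filter_subset _ _
  · intro i _ j _ hij
    refine Finset.disjoint_left.2 fun n hi hj => ?_
    rw [Finset.mem_filter] at hi hj
    rcases lt_or_gt_of_ne hij with h | h
    · exact (hE i j h n hi.2 n hj.2).false
    · exact (hE j i h n hj.2 n hi.2).false

namespace IsSchlumprecht

theorem bddAbove (e : ℕ → S) (a : ℕ →₀ ℝ) :
    BddAbove {c : ℝ | ∃ r : ℕ, 2 ≤ r ∧ ∃ E : Fin r → Finset ℕ, Succ E ∧
      c = (schF r)⁻¹ * ∑ i, ‖embed e (restr a (E i))‖} := by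
  refine ⟨∑ n ∈ a.support, ‖a n • e n‖, ?_⟩
  rintro _ ⟨r, hr, E, hE, rfl⟩
  have h1 : (schF r)⁻¹ ≤ 1 := inv_le_one_of_one_le₀ (one_lt_schF_two.le.trans (schF_two_le hr))
  exact (mul_le_of_le_one_left (Finset.sum_nonneg fun _ _ => norm_nonneg _) h1).trans
    (sum_norm_embed_restr_le a hE)

theorem abs_le_norm_embed (hS : IsSchlumprecht S e) (a : ℕ →₀ ℝ) (n : ℕ) :
    |a n| ≤ ‖embed e a‖ := by
  rw [hS.norm_eq]
  have hb : BddAbove (Set.range fun i => |a i|) :=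
    (a.finite_range.image abs).bddAbove.mono (by rintro _ ⟨i, rfl⟩; exact ⟨a i, ⟨i, rfl⟩, rfl⟩)
  exact (le_ciSup hb n).trans (le_max_left _ _)

theorem inv_mul_sum_le (hS : IsSchlumprecht S e) (a : ℕ →₀ ℝ) {r : ℕ} (hr : 2 ≤ r)
    {E : Fin r → Finset ℕ} (hE : Succ E) :
    (schF r)⁻¹ * ∑ i, ‖embed e (restr a (E i))‖ ≤ ‖embed e a‖ := by
  conv_rhs => rw [hS.norm_eq]
  exact (le_csSup (bddAbove e a) ⟨r, hr, E, hE, rfl⟩).trans (le_max_right _ _)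

theorem norm_embed_le (hS : IsSchlumprecht S e) {a : ℕ →₀ ℝ} {M : ℝ} (hM : ∀ n, |a n| ≤ M)
    (h : ∀ r : ℕ, 2 ≤ r → ∀ E : Fin r → Finset ℕ, Succ E →
      (schF r)⁻¹ * ∑ i, ‖embed e (restr a (E i))‖ ≤ M) :
    ‖embed e a‖ ≤ M := by
  rw [hS.norm_eq]
  refine max_le (ciSup_le hM) (Real.sSup_le ?_ ((abs_nonneg _).trans (hM 0)))
  rintro _ ⟨r, hr, E, hE, rfl⟩
  exact h r hr E hE

/-- The unit vector basis is 1-unconditional and 1-spreading. -/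
theorem norm_embed_le_of_strictMonoOn (hS : IsSchlumprecht S e) {a b : ℕ →₀ ℝ} {φ : ℕ → ℕ}
    (hφ : StrictMonoOn φ a.support) (hab : ∀ n ∈ a.support, |a n| ≤ |b (φ n)|) :
    ‖embed e a‖ ≤ ‖embed e b‖ := by
  induction hn : a.support.card using Nat.strong_induction_on generalizing a b with
  | _ n ih =>
  subst hn
  have key : ‖embed e a‖ ≤ max ‖embed e b‖ ((schF 2)⁻¹ * ‖embed e a‖) := by
    refine hS.norm_embed_le (fun n => le_max_of_le_left ?_) fun r hr E hE => ?_
    · by_cases hn : n ∈ a.support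
      · exact (hab n hn).trans (hS.abs_le_norm_embed b _)
      · rw [Finsupp.notMem_support_iff.1 hn, abs_zero]
        exact norm_nonneg _
    have hr0 : 0 < schF r := zero_lt_one.trans (one_lt_schF_two.trans_le (schF_two_le hr))
    by_cases hsub : ∃ i, a.support ⊆ E i
    · obtain ⟨i, hi⟩ := hsub
      refine le_max_of_le_right ?_
      have hsum : ∑ j, ‖embed e (restr a (E j))‖ = ‖embed e a‖ := by
        rw [Finset.sum_eq_single i, restr_eq_self hi]
        · intro j _ hj
          have : restr a (E j) = 0 := by
            ext m
            rw [restr_apply, Finsupp.zero_apply, ite_eq_right_iff]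
            intro hm
            by_contra hne
            have hmi := hi (Finsupp.mem_support_iff.2 hne)
            rcases lt_or_gt_of_ne hj with h | h
            · exact (hE j i h m hm m hmi).false
            · exact (hE i j h m hmi m hm).false
          rw [this, embed_zero, norm_zero]
        · simp
      rw [hsum]
      gcongr
      · exact zero_lt_one.trans one_lt_schF_two
      · exact schF_two_le hr
    · push Not at hsub
      refine le_max_of_le_left ?_
      let F : Fin r → Finset ℕ := fun i => (a.support.filter (· ∈ E i)).image φ
      have hF : Succ F := by
        intro i j hij m hm n hn
        obtain ⟨m, hm', rfl⟩ := Finset.mem_image.1 hm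
        obtain ⟨n, hn', rfl⟩ := Finset.mem_image.1 hn
        rw [Finset.mem_filter] at hm' hn'
        exact hφ hm'.1 hn'.1 (hE i j hij m hm'.2 n hn'.2)
      refine le_trans ?_ (hS.inv_mul_sum_le b hr hF)
      refine mul_le_mul_of_nonneg_left (Finset.sum_le_sum fun i _ => ?_) (inv_nonneg.2 hr0.le)
      refine ih _ ?_ (a := restr a (E i)) (b := restr b (F i)) ?_ ?_ rfl
      · rw [support_restr]
        refine Finset.card_lt_card (Finset.filter_ssubset.2 ?_)
        exact Finset.not_subset.1 (hsub i)
      · rw [support_restr]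
        exact hφ.mono (Finset.coe_subset.2 (Finset.filter_subset _ _))
      · intro n hn
        rw [support_restr] at hn
        rw [restr_apply, restr_apply, if_pos (Finset.mem_filter.1 hn).2,
          if_pos (Finset.mem_image_of_mem φ hn)]
        exact hab n (Finset.mem_filter.1 hn).1
  rcases le_max_iff.1 key with h | h
  · exact h
  · have h1 : (schF 2)⁻¹ < 1 := inv_lt_one_of_one_lt₀ one_lt_schF_two
    nlinarith [norm_nonneg (embed e a), norm_nonneg (embed e b)]

end IsSchlumprecht

end Seq

/-- the Schlumprecht space `S` is isomorphic (linearly homeomorphic) to its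
square `S ⊕ S` (with, e.g., the max norm, which is the product norm on `S × S`). -/
theorem schlumprecht_iso_square {S : Type*} [NormedAddCommGroup S] [NormedSpace ℝ S]
    [CompleteSpace S] (e : ℕ → S) (hS : IsSchlumprecht S e) :
    Nonempty (S ≃L[ℝ] S × S) := by
  let φ : (ℕ →₀ ℝ) ≃ₗ[ℝ] (ℕ →₀ ℝ) × (ℕ →₀ ℝ) :=
    Finsupp.domLCongr Equiv.natSumNatEquivNat.symm ≪≫ₗ Finsupp.sumFinsuppLEquivProdFinsupp ℝ
  have hφ₁ (x : ℕ →₀ ℝ) (i : ℕ) : (φ x).1 i = x (2 * i) := by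
    simp [φ]
  have hφ₂ (x : ℕ →₀ ℝ) (i : ℕ) : (φ x).2 i = x (2 * i + 1) := by
    simp [φ]
  let ι : (ℕ →₀ ℝ) →ₗ[ℝ] S := Finsupp.linearCombination ℝ e
  have hι (a : ℕ →₀ ℝ) : ι a = embed e a := rfl
  have hdense : DenseRange ι := by
    have : Set.range ι = (Submodule.span ℝ (Set.range e) : Set S) := by
      rw [← Finsupp.range_linearCombination]; rfl
    rw [DenseRange, this]
    exact hS.dense_span
  have hdense₂ : DenseRange (ι.prodMap ι) := hdense.prodMap hdense
  refine ⟨φ.extend ι (ι.prodMap ι) hdense ⟨1, fun x => ?_⟩ hdense₂ ⟨2, fun y => ?_⟩⟩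
  · rw [LinearMap.prodMap_apply, Prod.norm_mk, one_mul, hι, hι, hι]
    refine max_le (hS.norm_embed_le_of_strictMonoOn (φ := fun i => 2 * i) ?_ ?_)
      (hS.norm_embed_le_of_strictMonoOn (φ := fun i => 2 * i + 1) ?_ ?_)
    · intro i _ j _ hij; dsimp only; omega
    · intro i _; rw [hφ₁]
    · intro i _ j _ hij; dsimp only; omega
    · intro i _; rw [hφ₂]
  · obtain ⟨x, rfl⟩ := φ.surjective y
    rw [LinearEquiv.symm_apply_apply, LinearMap.prodMap_apply, Prod.norm_mk]
    have hx : x = x.filter Even + x.filter (fun i => ¬ Even i) :=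
      (Finsupp.filter_add_filter_not x _).symm
    have h₁ : ‖ι (x.filter Even)‖ ≤ ‖ι (φ x).1‖ := by
      refine hS.norm_embed_le_of_strictMonoOn (φ := fun i => i / 2) ?_ ?_
      · intro i hi j hj hij
        simp only [Finsupp.support_filter, Finset.coe_filter, Set.mem_ofPred_eq] at hi hj
        have := hi.2; have := hj.2
        dsimp only; grind
      · intro i hi
        rw [Finsupp.support_filter, Finset.mem_filter] at hi
        rw [Finsupp.filter_apply_pos _ _ hi.2, hφ₁, Nat.two_mul_div_two_of_even hi.2]
    have h₂ : ‖ι (x.filter (fun i => ¬ Even i))‖ ≤ ‖ι (φ x).2‖ := by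
      refine hS.norm_embed_le_of_strictMonoOn (φ := fun i => i / 2) ?_ ?_
      · intro i hi j hj hij
        simp only [Finsupp.support_filter, Finset.coe_filter, Set.mem_ofPred_eq] at hi hj
        have := hi.2; have := hj.2
        dsimp only; grind
      · intro i hi
        rw [Finsupp.support_filter, Finset.mem_filter] at hi
        rw [Finsupp.filter_apply_pos (fun i => ¬ Even i) x hi.2, hφ₂,
          Nat.two_mul_div_two_add_one_of_odd (Nat.not_even_iff_odd.mp hi.2)]
    calc ‖ι x‖ = ‖ι (x.filter Even) + ι (x.filter (fun i => ¬ Even i))‖ := by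
          rw [← map_add, ← hx]
      _ ≤ ‖ι (φ x).1‖ + ‖ι (φ x).2‖ := (norm_add_le _ _).trans (add_le_add h₁ h₂)
      _ ≤ 2 * max ‖ι (φ x).1‖ ‖ι (φ x).2‖ := by
          linarith [le_max_left ‖ι (φ x).1‖ ‖ι (φ x).2‖, le_max_right ‖ι (φ x).1‖ ‖ι (φ x).2‖]
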